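/- There is no closed real Lagrangian submanifold in the standard symplectic vector space (ℝ^{2n}, ω₀ = Σⱼ dxⱼ ∧ dyⱼ); i.e., no antisymplectic involution of (ℝ^{2n}, ω₀) has a nonempty closed (compact, boundaryless) manifold as its fixed point set. -/

import Mathlib

open scoped Manifold LinearAlgebra.Projectivization
open Set Function Module CategoryTheory Topology

noncomputable section

/-- A symplectic form on a manifold `M` modeled on `(E, H)` via `I`: a smooth family of
nondegenerate antisymmetric continuous bilinear forms on the tangent spaces (recall that
`TangentSpace I x` is definitionally `E`).  (The closedness condition `dω = 0` plays no role
in any of the arguments and is not formalized.) -/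
def IsSymplecticForm {E H : Type} [NormedAddCommGroup E] [NormedSpace ℝ E]
    [TopologicalSpace H] (I : ModelWithCorners ℝ E H)
    (M : Type) [TopologicalSpace M] [ChartedSpace H M]
    (ω : M → E →L[ℝ] E →L[ℝ] ℝ) : Prop :=
  ContMDiff I 𝓘(ℝ, E →L[ℝ] E →L[ℝ] ℝ) (⊤ : ℕ∞) ω ∧
  (∀ x u v, ω x u v = - ω x v u) ∧
  (∀ x u, (∀ v, ω x u v = 0) → u = 0)

/-- An antisymplectic involution of `(M, ω)`: a smooth map `R : M → M` with `R ∘ R = id`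
and `R^* ω = - ω`. -/
def IsAntisymplecticInvolution {E H : Type} [NormedAddCommGroup E] [NormedSpace ℝ E]
    [TopologicalSpace H] (I : ModelWithCorners ℝ E H)
    (M : Type) [TopologicalSpace M] [ChartedSpace H M]
    (ω : M → E →L[ℝ] E →L[ℝ] ℝ) (R : M → M) : Prop :=
  ContMDiff I I (⊤ : ℕ∞) R ∧ R ∘ R = id ∧
  ∀ (x : M) (u v : TangentSpace I x),
    ω (R x) (mfderiv I I R x u) (mfderiv I I R x v) = - ω x u v

/-- A subset `L ⊆ M` is a real Lagrangian submanifold of `(M, ω)` if it is the nonempty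
fixed point set of an antisymplectic involution. -/
def IsRealLagrangianSet {E H : Type} [NormedAddCommGroup E] [NormedSpace ℝ E]
    [TopologicalSpace H] (I : ModelWithCorners ℝ E H)
    (M : Type) [TopologicalSpace M] [ChartedSpace H M]
    (ω : M → E →L[ℝ] E →L[ℝ] ℝ) (L : Set M) : Prop :=
  L.Nonempty ∧ ∃ R : M → M, IsAntisymplecticInvolution I M ω R ∧ L = {x | R x = x}

/-- The standard constant symplectic form `ω₀ = Σⱼ dxⱼ ∧ dyⱼ` on `ℝ^(2n)`, where
`xⱼ = x_{2j}` and `yⱼ = x_{2j+1}` in coordinates. -/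
def stdSymplecticForm (n : ℕ) :
    EuclideanSpace ℝ (Fin (2 * n)) →L[ℝ] EuclideanSpace ℝ (Fin (2 * n)) →L[ℝ] ℝ :=
  ∑ i : Fin n,
    ((EuclideanSpace.proj (⟨2 * i, by omega⟩ : Fin (2 * n))).smulRight
        (EuclideanSpace.proj (⟨2 * i + 1, by omega⟩ : Fin (2 * n))) -
      (EuclideanSpace.proj (⟨2 * i + 1, by omega⟩ : Fin (2 * n))).smulRight
        (EuclideanSpace.proj (⟨2 * i, by omega⟩ : Fin (2 * n))))

/-! ### Chains of finite tuples modulo two -/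

namespace SmallChain

/-- Formal sums modulo two of lists of points; a list of length `j` is a possibly degenerate
simplex of dimension `j - 1`, so that the complex they form is augmented. -/
abbrev Chain (X : Type*) := List X →₀ ZMod 2

section Algebra

variable {X Y Z : Type*}

theorem map_mem_of_single {N : Type*} [AddCommGroup N] [Module (ZMod 2) N] {s : Set (List X)}
    {P : Submodule (ZMod 2) N} (L : Chain X →ₗ[ZMod 2] N)
    (h : ∀ l ∈ s, L (Finsupp.single l 1) ∈ P) {c : Chain X}
    (hc : c ∈ Finsupp.supported (ZMod 2) (ZMod 2) s) : L c ∈ P := by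
  rw [Finsupp.supported_eq_span_single] at hc
  have : Submodule.span (ZMod 2) ((fun l => Finsupp.single l (1 : ZMod 2)) '' s) ≤ P.comap L := by
    rw [Submodule.span_le]
    rintro _ ⟨l, hl, rfl⟩
    exact h l hl
  exact this hc

theorem eq_of_eq_on_single {N : Type*} [AddCommGroup N] [Module (ZMod 2) N] {s : Set (List X)}
    (L L' : Chain X →ₗ[ZMod 2] N)
    (h : ∀ l ∈ s, L (Finsupp.single l 1) = L' (Finsupp.single l 1)) {c : Chain X}
    (hc : c ∈ Finsupp.supported (ZMod 2) (ZMod 2) s) : L c = L' c := by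
  have := map_mem_of_single (P := ⊥) (L - L')
    (fun l hl => by simp [h l hl]) hc
  simpa [sub_eq_zero] using this

theorem linearMap_ext {N : Type*} [AddCommGroup N] [Module (ZMod 2) N]
    {L L' : Chain X →ₗ[ZMod 2] N}
    (h : ∀ l, L (Finsupp.single l 1) = L' (Finsupp.single l 1)) (c : Chain X) : L c = L' c :=
  eq_of_eq_on_single (s := Set.univ) L L' (fun l _ => h l) (by simp)

/-- Prepending a vertex. -/
def cone (x : X) : Chain X →ₗ[ZMod 2] Chain X := Finsupp.lmapDomain _ _ (List.cons x)

@[simp] theorem cone_single (x : X) (l : List X) (a : ZMod 2) :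
    cone x (Finsupp.single l a) = Finsupp.single (x :: l) a := by
  simp [cone]

/-- The chain map induced by a map of points. -/
def push (g : X → Y) : Chain X →ₗ[ZMod 2] Chain Y := Finsupp.lmapDomain _ _ (List.map g)

@[simp] theorem push_single (g : X → Y) (l : List X) (a : ZMod 2) :
    push g (Finsupp.single l a) = Finsupp.single (l.map g) a := by
  simp [push]

/-- The sum of all facets of a list. -/
def bdryList : List X → Chain X
  | [] => 0
  | x :: l => Finsupp.single l 1 + cone x (bdryList l)

/-- The boundary operator. -/
def bdry : Chain X →ₗ[ZMod 2] Chain X := Finsupp.linearCombination (ZMod 2) bdryList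

@[simp] theorem bdry_single (l : List X) : bdry (Finsupp.single l 1) = bdryList l := by
  simp [bdry]

theorem bdry_cone (x : X) (c : Chain X) : bdry (cone x c) = c + cone x (bdry c) :=
  linearMap_ext (L := bdry ∘ₗ cone x) (L' := LinearMap.id + cone x ∘ₗ bdry)
    (fun l => by simp [bdryList]) c

theorem push_cone (g : X → Y) (x : X) (c : Chain X) : push g (cone x c) = cone (g x) (push g c) :=
  linearMap_ext (L := push g ∘ₗ cone x) (L' := cone (g x) ∘ₗ push g) (fun l => by simp) c

theorem bdry_bdryList (l : List X) : bdry (bdryList l) = 0 := by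
  induction l with
  | nil => simp [bdryList]
  | cons x l ih => simp [bdryList, bdry_cone, ih, ZModModule.add_self]

theorem bdry_bdry (c : Chain X) : bdry (bdry c) = 0 :=
  linearMap_ext (L := bdry ∘ₗ bdry) (L' := 0) (fun l => by simp [bdry_bdryList]) c

theorem push_bdryList (g : X → Y) (l : List X) : push g (bdryList l) = bdryList (l.map g) := by
  induction l with
  | nil => simp [bdryList]
  | cons x l ih => simp [bdryList, push_cone, ih]

theorem bdry_push (g : X → Y) (c : Chain X) : bdry (push g c) = push g (bdry c) :=
  linearMap_ext (L := bdry ∘ₗ push g) (L' := push g ∘ₗ bdry)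
    (fun l => by simp [push_bdryList]) c

theorem push_push (h : Y → Z) (g : X → Y) (c : Chain X) : push h (push g c) = push (h ∘ g) c :=
  linearMap_ext (L := push h ∘ₗ push g) (L' := push (h ∘ g)) (fun l => by simp) c

theorem push_push_of_involutive {g : X → X} (hg : Function.Involutive g) (c : Chain X) :
    push g (push g c) = c :=
  linearMap_ext (L := push g ∘ₗ push g) (L' := LinearMap.id)
    (fun l => by simp [hg.comp_self]) c

/-- The prism between the images of a list under two maps. -/
def prismList (g h : X → Y) : List X → Chain Y
  | [] => 0
  | x :: l => Finsupp.single (g x :: h x :: l.map h) 1 + cone (g x) (prismList g h l)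

/-- The prism operator, a chain homotopy between two pushforwards. -/
def prism (g h : X → Y) : Chain X →ₗ[ZMod 2] Chain Y :=
  Finsupp.linearCombination (ZMod 2) (prismList g h)

@[simp] theorem prism_single (g h : X → Y) (l : List X) :
    prism g h (Finsupp.single l 1) = prismList g h l := by
  simp [prism]

theorem prism_cone (g h : X → Y) (x : X) (c : Chain X) :
    prism g h (cone x c) = cone (g x) (cone (h x) (push h c)) + cone (g x) (prism g h c) :=
  linearMap_ext (L := prism g h ∘ₗ cone x)
    (L' := cone (g x) ∘ₗ cone (h x) ∘ₗ push h + cone (g x) ∘ₗ prism g h)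
    (fun l => by simp [prismList]) c

theorem bdry_prismList (g h : X → Y) (l : List X) :
    bdry (prismList g h l) =
      prism g h (bdryList l) + Finsupp.single (l.map g) 1 + Finsupp.single (l.map h) 1 := by
  induction l with
  | nil => simp [prismList, bdryList, ZModModule.add_self]
  | cons x l ih =>
    have e1 := ZModModule.add_self (prismList g h l)
    have e2 := ZModModule.add_self (Finsupp.single (g x :: l.map h) (1 : ZMod 2))
    simp only [prismList, bdryList, map_add, bdry_cone, bdry_single, ih, prism_single,
      prism_cone, cone_single, push_bdryList, List.map_cons]
    grind

theorem bdry_prism (g h : X → Y) (c : Chain X) :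
    bdry (prism g h c) = prism g h (bdry c) + push g c + push h c :=
  linearMap_ext (L := bdry ∘ₗ prism g h) (L' := prism g h ∘ₗ bdry + push g + push h)
    (fun l => by simp [bdry_prismList]) c

theorem bdryList_mem (l : List X) :
    bdryList l ∈ Finsupp.supported (ZMod 2) (ZMod 2)
      {k : List X | k.Sublist l ∧ k.length + 1 = l.length} := by
  induction l with
  | nil => simp [bdryList]
  | cons x l ih =>
    refine Submodule.add_mem _ (Finsupp.single_mem_supported _ _ (by simp)) ?_
    refine map_mem_of_single (cone x) (fun k hk => ?_) ih
    rw [cone_single]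
    exact Finsupp.single_mem_supported _ _ ⟨hk.1.cons_cons x, by simp [hk.2]⟩

theorem prismList_mem (g h : X → Y) (l : List X) :
    prismList g h l ∈ Finsupp.supported (ZMod 2) (ZMod 2)
      {k : List Y | k.length = l.length + 1 ∧ ∀ y ∈ k, ∃ x ∈ l, y = g x ∨ y = h x} := by
  induction l with
  | nil => simp [prismList]
  | cons x l ih =>
    refine Submodule.add_mem _ (Finsupp.single_mem_supported _ _ ⟨by simp, by simp; grind⟩) ?_
    refine map_mem_of_single (cone (g x)) (fun k hk => ?_) ih
    rw [cone_single]
    refine Finsupp.single_mem_supported _ _ ⟨by simp [hk.1], ?_⟩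
    have := hk.2
    grind

end Algebra

/-! ### Small chains and acyclicity -/

section Small

variable {X Y : Type*}

open Classical in
/-- The part of a chain consisting of the lists with a given property. -/
def restrict (p : List X → Prop) : Chain X →ₗ[ZMod 2] Chain X where
  toFun := Finsupp.filter p
  map_add' _ _ := Finsupp.filter_add
  map_smul' _ _ := Finsupp.filter_smul

/-- The lists of length `j` in `U` whose set of vertices is small. -/
def smallLists (U : Set X) (S : Set (Set X)) (j : ℕ) : Set (List X) :=
  {l | l.length = j ∧ (∀ x ∈ l, x ∈ U) ∧ {x | x ∈ l} ∈ S}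

/-- The small chains of lists of length `j` in `U`. -/
def chains (U : Set X) (S : Set (Set X)) (j : ℕ) : Submodule (ZMod 2) (Chain X) :=
  Finsupp.supported (ZMod 2) (ZMod 2) (smallLists U S j)

theorem chains_mono {U V : Set X} {S T : Set (Set X)} (h : U ⊆ V) (h' : S ⊆ T) (j : ℕ) :
    chains U S j ≤ chains V T j :=
  Finsupp.supported_mono fun _ hl => ⟨hl.1, fun x hx => h (hl.2.1 x hx), h' hl.2.2⟩

theorem single_mem_chains {U : Set X} {S : Set (Set X)} {j : ℕ} {l : List X}
    (hl : l ∈ smallLists U S j) : Finsupp.single l 1 ∈ chains U S j :=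
  Finsupp.single_mem_supported _ _ hl

theorem push_mem {U : Set X} {V : Set Y} {S : Set (Set Y)} {g : X → Y} (h : Set.MapsTo g U V)
    {j : ℕ} {c : Chain X} (hc : c ∈ chains U {A | g '' A ∈ S} j) : push g c ∈ chains V S j := by
  refine map_mem_of_single (push g) (fun l hl => ?_) hc
  rw [push_single]
  refine single_mem_chains ⟨by simp [hl.1], ?_, ?_⟩
  · intro y hy
    obtain ⟨x, hx, rfl⟩ := List.mem_map.1 hy
    exact h (hl.2.1 x hx)
  · have : {y | y ∈ l.map g} = g '' {x | x ∈ l} := by ext; simp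
    rw [this]
    exact hl.2.2

theorem push_congr {U : Set X} {S : Set (Set X)} {g h : X → Y} (e : Set.EqOn g h U) {j : ℕ}
    {c : Chain X} (hc : c ∈ chains U S j) : push g c = push h c := by
  refine eq_of_eq_on_single (push g) (push h) (fun l hl => ?_) hc
  rw [push_single, push_single, List.map_congr_left fun x hx => e (hl.2.1 x hx)]

theorem push_eq_self {U : Set X} {S : Set (Set X)} {g : X → X} (e : Set.EqOn g id U) {j : ℕ}
    {c : Chain X} (hc : c ∈ chains U S j) : push g c = c := by
  rw [push_congr e hc]
  exact linearMap_ext (L := push id) (L' := LinearMap.id) (fun l => by simp) c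

/-- The chain `c` of lists of length `j` is the boundary of a small chain. -/
def Bounds (U : Set X) (S : Set (Set X)) (j : ℕ) (c : Chain X) : Prop :=
  ∃ b ∈ chains U S (j + 1), bdry b = c

theorem Bounds.add {U : Set X} {S : Set (Set X)} {j : ℕ} {c c' : Chain X}
    (h : Bounds U S j c) (h' : Bounds U S j c') : Bounds U S j (c + c') := by
  obtain ⟨b, hb, rfl⟩ := h
  obtain ⟨b', hb', rfl⟩ := h'
  exact ⟨b + b', Submodule.add_mem _ hb hb', map_add _ _ _⟩

theorem Bounds.mono {U V : Set X} {S T : Set (Set X)} (h : U ⊆ V) (h' : S ⊆ T) {j : ℕ}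
    {c : Chain X} (hc : Bounds U S j c) : Bounds V T j c := by
  obtain ⟨b, hb, rfl⟩ := hc
  exact ⟨b, chains_mono h h' _ hb, rfl⟩

theorem Bounds.push {U : Set X} {V : Set Y} {S : Set (Set Y)} {g : X → Y} (h : Set.MapsTo g U V)
    {j : ℕ} {c : Chain X} (hc : Bounds U {A | g '' A ∈ S} j c) :
    Bounds V S j (SmallChain.push g c) := by
  obtain ⟨b, hb, rfl⟩ := hc
  exact ⟨SmallChain.push g b, push_mem h hb, bdry_push g b⟩

variable [TopologicalSpace X] [TopologicalSpace Y]

/-- A gauge on `U` is a hereditary family of sets, thought of as the small ones, containing a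
neighborhood within `U` of every point of `U`. -/
structure IsGauge (U : Set X) (S : Set (Set X)) : Prop where
  empty_mem : ∅ ∈ S
  mono : ∀ {A B : Set X}, A ∈ S → B ⊆ A → B ∈ S
  exists_nhds : ∀ x ∈ U, ∃ N ∈ 𝓝[U] x, N ∈ S

theorem IsGauge.inter {U : Set X} {S T : Set (Set X)} (hS : IsGauge U S) (hT : IsGauge U T) :
    IsGauge U (S ∩ T) where
  empty_mem := ⟨hS.empty_mem, hT.empty_mem⟩
  mono hA hB := ⟨hS.mono hA.1 hB, hT.mono hA.2 hB⟩
  exists_nhds x hx := by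
    obtain ⟨N, hN, hNS⟩ := hS.exists_nhds x hx
    obtain ⟨M, hM, hMT⟩ := hT.exists_nhds x hx
    exact ⟨N ∩ M, Filter.inter_mem hN hM, hS.mono hNS Set.inter_subset_left,
      hT.mono hMT Set.inter_subset_right⟩

theorem IsGauge.subset {U V : Set X} {S : Set (Set X)} (hS : IsGauge U S) (h : V ⊆ U) :
    IsGauge V S where
  empty_mem := hS.empty_mem
  mono := hS.mono
  exists_nhds x hx := by
    obtain ⟨N, hN, hNS⟩ := hS.exists_nhds x (h hx)
    exact ⟨N, nhdsWithin_mono _ h hN, hNS⟩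

theorem IsGauge.comap {U : Set X} {V : Set Y} {S : Set (Set Y)} (hS : IsGauge V S) {g : X → Y}
    (hg : ContinuousOn g U) (h : Set.MapsTo g U V) : IsGauge U {A | g '' A ∈ S} where
  empty_mem := by simpa using hS.empty_mem
  mono hA hB := hS.mono hA (Set.image_mono hB)
  exists_nhds x hx := by
    obtain ⟨N, hN, hNS⟩ := hS.exists_nhds (g x) (h hx)
    exact ⟨g ⁻¹' N, (hg x hx).tendsto_nhdsWithin h hN,
      hS.mono hNS (Set.image_preimage_subset g N)⟩

theorem isGauge_univ (U : Set X) : IsGauge U Set.univ where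
  empty_mem := trivial
  mono _ _ := trivial
  exists_nhds _ _ := ⟨Set.univ, Filter.univ_mem, trivial⟩

/-- Fine cycles of lists of length `j` bound: vanishing of the reduced homology modulo two in
dimension `j - 1`. -/
def Acyclic (U : Set X) (j : ℕ) : Prop :=
  ∀ S, IsGauge U S → ∃ T, IsGauge U T ∧ ∀ c ∈ chains U T j, bdry c = 0 → Bounds U S j c

/-- Among two fine cycles and their sum one bounds: the reduced homology modulo two in dimension
`j - 1` has rank at most one. -/
def RankLEOne (U : Set X) (j : ℕ) : Prop :=
  ∀ S, IsGauge U S → ∃ T, IsGauge U T ∧ ∀ c ∈ chains U T j, ∀ c' ∈ chains U T j,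
    bdry c = 0 → bdry c' = 0 → Bounds U S j c ∨ Bounds U S j c' ∨ Bounds U S j (c + c')

/-- The linear map `L` takes fine cycles in `U` to fine cycles in `V`, injectively in homology. -/
def Reduces (U : Set X) (j : ℕ) (V : Set Y) (k : ℕ) (L : Chain X →ₗ[ZMod 2] Chain Y) : Prop :=
  ∀ S, IsGauge U S → ∃ T, IsGauge V T ∧ ∀ T', IsGauge V T' → ∃ S', IsGauge U S' ∧
    ∀ c ∈ chains U S' j, bdry c = 0 →
      L c ∈ chains V T' k ∧ bdry (L c) = 0 ∧ (Bounds V T k (L c) → Bounds U S j c)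

theorem Reduces.acyclic {U : Set X} {j : ℕ} {V : Set Y} {k : ℕ} {L : Chain X →ₗ[ZMod 2] Chain Y}
    (h : Reduces U j V k L) (hV : Acyclic V k) : Acyclic U j := by
  intro S hS
  obtain ⟨T, hT, h⟩ := h S hS
  obtain ⟨T', hT', hV⟩ := hV T hT
  obtain ⟨S', hS', h⟩ := h T' hT'
  refine ⟨S', hS', fun c hc hc0 => ?_⟩
  obtain ⟨h1, h2, h3⟩ := h c hc hc0
  exact h3 (hV _ h1 h2)

theorem Reduces.rankLEOne {U : Set X} {j : ℕ} {V : Set Y} {k : ℕ}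
    {L : Chain X →ₗ[ZMod 2] Chain Y} (h : Reduces U j V k L) (hV : RankLEOne V k) :
    RankLEOne U j := by
  intro S hS
  obtain ⟨T, hT, h⟩ := h S hS
  obtain ⟨T', hT', hV⟩ := hV T hT
  obtain ⟨S', hS', h⟩ := h T' hT'
  refine ⟨S', hS', fun c hc c' hc' hc0 hc0' => ?_⟩
  obtain ⟨h1, h2, h3⟩ := h c hc hc0
  obtain ⟨h1', h2', h3'⟩ := h c' hc' hc0'
  obtain ⟨-, -, h3''⟩ := h (c + c') (Submodule.add_mem _ hc hc') (by simp [hc0, hc0'])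
  rw [map_add] at h3''
  exact (hV _ h1 _ h1' h2 h2').imp h3 (Or.imp h3' h3'')

/-- Homotopy invariance: the two ends of a homotopy have homologous effects on fine cycles. -/
theorem exists_gauge_homotopy {P : Type*} [TopologicalSpace P] [CompactSpace P]
    [PreconnectedSpace P] {U : Set X} {V : Set Y} (H : P → X → Y)
    (hH : ContinuousOn (fun q : P × X => H q.1 q.2) (Set.univ ×ˢ U))
    (hUV : ∀ t, Set.MapsTo (H t) U V) {S : Set (Set Y)} (hS : IsGauge V S) :
    ∃ T, IsGauge U T ∧ ∀ j, ∀ c ∈ chains U T j, bdry c = 0 →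
      ∀ s t, Bounds V S j (push (H s) c + push (H t) c) := by
  refine ⟨{A | ∀ s, ∀ᶠ t in 𝓝 s, H s '' A ∪ H t '' A ∈ S}, ⟨?_, ?_, ?_⟩, ?_⟩
  · simp [hS.empty_mem]
  · intro A B hA hB s
    filter_upwards [hA s] with t ht
    exact hS.mono ht (Set.union_subset_union (Set.image_mono hB) (Set.image_mono hB))
  · intro x hx
    have key : ∃ M ∈ 𝓝[U] x, ∀ s ∈ (Set.univ : Set P),
        ∀ᶠ t in 𝓝 s, H s '' M ∪ H t '' M ∈ S := by
      refine isCompact_univ.induction_on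
        (p := fun B : Set P => ∃ M ∈ 𝓝[U] x, ∀ s ∈ B, ∀ᶠ t in 𝓝 s, H s '' M ∪ H t '' M ∈ S)
        ⟨Set.univ, Filter.univ_mem, by simp⟩ ?_ ?_ ?_
      · rintro B C hBC ⟨M, hM, h⟩
        exact ⟨M, hM, fun s hs => h s (hBC hs)⟩
      · rintro B C ⟨M, hM, h⟩ ⟨M', hM', h'⟩
        refine ⟨M ∩ M', Filter.inter_mem hM hM', ?_⟩
        rintro s (hs | hs)
        · filter_upwards [h s hs] with t ht
          exact hS.mono ht (by gcongr <;> exact Set.inter_subset_left)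
        · filter_upwards [h' s hs] with t ht
          exact hS.mono ht (by gcongr <;> exact Set.inter_subset_right)
      · intro s _
        obtain ⟨N, hN, hNS⟩ := hS.exists_nhds (H s x) (hUV s hx)
        have h1 : (fun q : P × X => H q.1 q.2) ⁻¹' N ∈ 𝓝[Set.univ ×ˢ U] (s, x) :=
          (hH (s, x) ⟨trivial, hx⟩).tendsto_nhdsWithin (fun q hq => hUV q.1 hq.2) hN
        rw [nhdsWithin_prod_eq, nhdsWithin_univ] at h1
        obtain ⟨B, hB, M, hM, hBM⟩ := Filter.mem_prod_iff.1 h1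
        refine ⟨interior B, by simpa using hB, M, hM, fun s' hs' => ?_⟩
        filter_upwards [isOpen_interior.mem_nhds hs'] with t ht
        refine hS.mono hNS ?_
        rintro _ (⟨y, hy, rfl⟩ | ⟨y, hy, rfl⟩)
        · exact hBM (Set.mk_mem_prod (interior_subset hs') hy)
        · exact hBM (Set.mk_mem_prod (interior_subset ht) hy)
    obtain ⟨M, hM, h⟩ := key
    exact ⟨M, hM, fun s => h s trivial⟩
  · intro j c hc hc0 s t
    refine isPreconnected_univ.induction₂
      (fun s t => Bounds V S j (push (H s) c + push (H t) c)) ?_ ?_ ?_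
      (Set.mem_univ s) (Set.mem_univ t)
    · intro s _
      rw [nhdsWithin_univ]
      have h1 : ∀ᶠ t in 𝓝 s, ∀ l ∈ c.support, H s '' {x | x ∈ l} ∪ H t '' {x | x ∈ l} ∈ S :=
        (Filter.eventually_all_finset c.support).2
          fun l hl => (((Finsupp.mem_supported _ _).1 hc) hl).2.2 s
      filter_upwards [h1] with t ht
      refine ⟨prism (H s) (H t) c, ?_, by simp [bdry_prism, hc0]⟩
      refine map_mem_of_single (s := (c.support : Set (List X))) (prism (H s) (H t))
        (fun l hl => ?_) (by simp [Finsupp.mem_supported])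
      rw [prism_single]
      obtain ⟨hl1, hl2, -⟩ := ((Finsupp.mem_supported _ _).1 hc) hl
      refine Finsupp.supported_mono (fun k hk => ?_) (prismList_mem (H s) (H t) l)
      refine ⟨by simp [hk.1, hl1], ?_, hS.mono (ht l hl) ?_⟩
      · intro y hy
        obtain ⟨x, hx, rfl | rfl⟩ := hk.2 y hy
        · exact hUV s (hl2 x hx)
        · exact hUV t (hl2 x hx)
      · intro y hy
        obtain ⟨x, hx, rfl | rfl⟩ := hk.2 y hy
        · exact Or.inl ⟨x, hx, rfl⟩
        · exact Or.inr ⟨x, hx, rfl⟩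
    · intro r s t _ _ _ h h'
      have e := ZModModule.add_self (push (H s) c)
      have : push (H r) c + push (H t) c =
          (push (H r) c + push (H s) c) + (push (H s) c + push (H t) c) := by grind
      rw [this]
      exact h.add h'
    · intro s t _ _ h
      rwa [add_comm]

/-- A set contracting onto one of its points is acyclic in all degrees. -/
theorem acyclic_of_contraction {P : Type*} [TopologicalSpace P] [CompactSpace P]
    [PreconnectedSpace P] {U : Set X} (H : P → X → X)
    (hH : ContinuousOn (fun q : P × X => H q.1 q.2) (Set.univ ×ˢ U))
    (hU : ∀ t, Set.MapsTo (H t) U U) {s t : P} {e : X} (he : e ∈ U) (hs : ∀ x ∈ U, H s x = x)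
    (ht : ∀ x ∈ U, H t x = e) (j : ℕ) : Acyclic U j := by
  intro S hS
  obtain ⟨T, hT, h⟩ := exists_gauge_homotopy H hH hU hS
  refine ⟨T, hT, fun c hc hc0 => ?_⟩
  have h1 := h j c hc hc0 s t
  rw [push_eq_self hs hc, push_congr (h := fun _ => e) ht hc] at h1
  have h2 : Bounds U S j (push (fun _ => e) c) := by
    refine ⟨cone e (push (fun _ => e) c), ?_, by simp [bdry_cone, bdry_push, hc0]⟩
    refine map_mem_of_single (cone e ∘ₗ push fun _ => e) (fun l hl => ?_) hc
    simp only [LinearMap.comp_apply, push_single, cone_single]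
    refine single_mem_chains ⟨by simp [hl.1], by simp; grind, ?_⟩
    obtain ⟨N, hN, hNS⟩ := hS.exists_nhds e he
    refine hS.mono hNS ?_
    intro y hy
    have : y = e := by simp at hy; grind
    exact this ▸ mem_of_mem_nhdsWithin he hN
  have := h1.add h2
  rwa [add_assoc, ZModModule.add_self, add_zero] at this

/-- A map with a homotopy left inverse is injective in homology. -/
theorem reduces_of_homotopy {P : Type*} [TopologicalSpace P] [CompactSpace P]
    [PreconnectedSpace P] {U : Set X} {V : Set Y} {g : X → Y} {h : Y → X}
    (hg : ContinuousOn g U) (hh : ContinuousOn h V) (hgU : Set.MapsTo g U V)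
    (hhV : Set.MapsTo h V U) (H : P → X → X)
    (hH : ContinuousOn (fun q : P × X => H q.1 q.2) (Set.univ ×ˢ U))
    (hU : ∀ t, Set.MapsTo (H t) U U) {s t : P} (hs : ∀ x ∈ U, H s x = x)
    (ht : ∀ x ∈ U, H t x = h (g x)) (j : ℕ) : Reduces U j V j (push g) := by
  intro S hS
  refine ⟨_, hS.comap hh hhV, fun T' hT' => ?_⟩
  obtain ⟨T, hT, hB⟩ := exists_gauge_homotopy H hH hU hS
  refine ⟨_, hT.inter (hT'.comap hg hgU), fun c hc hc0 => ⟨?_, by simp [bdry_push, hc0], ?_⟩⟩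
  · exact push_mem hgU (chains_mono subset_rfl Set.inter_subset_right _ hc)
  · intro h1
    have h2 := h1.push hhV
    have h3 := hB j c (chains_mono subset_rfl Set.inter_subset_left _ hc) hc0 s t
    rw [push_eq_self hs hc, push_congr (h := h ∘ g) ht hc] at h3
    rw [push_push] at h2
    have := h3.add h2
    rwa [add_assoc, ZModModule.add_self, add_zero] at this

/-- The Mayer–Vietoris connecting map is injective when both pieces are acyclic. -/
theorem reduces_mayerVietoris {U V G : Set X} (hU : IsOpen U) (hV : IsOpen V)
    (hGU : ∀ x ∈ U \ V, G ∈ 𝓝 x) (hGV : ∀ x ∈ V \ U, Gᶜ ∈ 𝓝 x) {j : ℕ}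
    (aU : Acyclic U (j + 1)) (aV : Acyclic V (j + 1)) :
    Reduces (U ∪ V) (j + 1) (U ∩ V) j (bdry ∘ₗ restrict fun l => ∃ x ∈ l, x ∈ G) := by
  intro S hS
  obtain ⟨SU, hSU, aU⟩ := aU S (hS.subset Set.subset_union_left)
  obtain ⟨SV, hSV, aV⟩ := aV S (hS.subset Set.subset_union_right)
  refine ⟨SU ∩ SV, (hSU.subset Set.inter_subset_left).inter (hSV.subset Set.inter_subset_right),
    fun T hT => ?_⟩
  refine ⟨{A | ((A ∩ G).Nonempty → A ⊆ U ∧ A ∈ SU ∧ A \ G ∈ T) ∧ A \ G ⊆ V ∧ A \ G ∈ SV},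
    ⟨?_, ?_, ?_⟩, ?_⟩
  · simp [hSV.empty_mem]
  · rintro A B ⟨h1, h2, h3⟩ hBA
    have hd : B \ G ⊆ A \ G := Set.sdiff_subset_sdiff_left hBA
    refine ⟨fun h => ?_, hd.trans h2, hSV.mono h3 hd⟩
    obtain ⟨h4, h5, h6⟩ := h1 (h.mono (Set.inter_subset_inter_left _ hBA))
    exact ⟨hBA.trans h4, hSU.mono h5 hBA, hT.mono h6 hd⟩
  · intro x hx
    by_cases hxU : x ∈ U <;> by_cases hxV : x ∈ V
    · obtain ⟨M, hM, hMS⟩ := hSU.exists_nhds x hxU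
      obtain ⟨N, hN, hNS⟩ := hSV.exists_nhds x hxV
      obtain ⟨K, hK, hKS⟩ := hT.exists_nhds x ⟨hxU, hxV⟩
      rw [hU.nhdsWithin_eq hxU] at hM
      rw [hV.nhdsWithin_eq hxV] at hN
      rw [(hU.inter hV).nhdsWithin_eq ⟨hxU, hxV⟩] at hK
      refine ⟨(U ∩ V) ∩ (M ∩ (N ∩ K)), mem_nhdsWithin_of_mem_nhds ?_, fun _ => ⟨?_, ?_, ?_⟩,
        ?_, ?_⟩
      · exact Filter.inter_mem ((hU.inter hV).mem_nhds ⟨hxU, hxV⟩)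
          (Filter.inter_mem hM (Filter.inter_mem hN hK))
      · exact fun y hy => hy.1.1
      · exact hSU.mono hMS fun y hy => hy.2.1
      · exact hT.mono hKS fun y hy => hy.1.2.2.2
      · exact fun y hy => hy.1.1.2
      · exact hSV.mono hNS fun y hy => hy.1.2.2.1
    · obtain ⟨M, hM, hMS⟩ := hSU.exists_nhds x hxU
      rw [hU.nhdsWithin_eq hxU] at hM
      have hd : (G ∩ (U ∩ M)) \ G = ∅ := Set.sdiff_eq_empty.2 Set.inter_subset_left
      refine ⟨G ∩ (U ∩ M), mem_nhdsWithin_of_mem_nhds ?_, fun _ => ⟨?_, ?_, ?_⟩, ?_, ?_⟩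
      · exact Filter.inter_mem (hGU x ⟨hxU, hxV⟩) (Filter.inter_mem (hU.mem_nhds hxU) hM)
      · exact fun y hy => hy.2.1
      · exact hSU.mono hMS fun y hy => hy.2.2
      · exact hd ▸ hT.empty_mem
      · exact hd ▸ Set.empty_subset _
      · exact hd ▸ hSV.empty_mem
    · obtain ⟨M, hM, hMS⟩ := hSV.exists_nhds x hxV
      rw [hV.nhdsWithin_eq hxV] at hM
      refine ⟨Gᶜ ∩ (V ∩ M), mem_nhdsWithin_of_mem_nhds ?_, fun h => ?_, ?_, ?_⟩
      · exact Filter.inter_mem (hGV x ⟨hxV, hxU⟩) (Filter.inter_mem (hV.mem_nhds hxV) hM)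
      · obtain ⟨y, hy, hy'⟩ := h
        exact absurd hy' hy.1
      · exact fun y hy => hy.1.2.1
      · exact hSV.mono hMS fun y hy => hy.1.2.2
    · exact absurd hx (by simp [hxU, hxV])
  · intro c hc hc0
    set p : List X → Prop := fun l => ∃ x ∈ l, x ∈ G with hp
    have e := ZModModule.add_self (restrict p c)
    have hsupp : ∀ l ∈ (restrict p c).support, l ∈ c.support ∧ p l := by
      intro l hl
      classical
      simpa [restrict, Finsupp.support_filter] using hl
    have hsupp' : ∀ l ∈ (c + restrict p c).support, l ∈ c.support ∧ ¬ p l := by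
      intro l hl
      classical
      rw [Finsupp.mem_support_iff] at hl ⊢
      by_cases h : p l
      · refine absurd ?_ hl
        simp [restrict, h, CharTwo.add_self_eq_zero]
      · exact ⟨by simpa [restrict, Finsupp.filter_apply, h] using hl, h⟩
    have hc' : ∀ l ∈ c.support, _ := fun l hl => ((Finsupp.mem_supported _ _).1 hc) hl
    have hcU : restrict p c ∈ chains U SU (j + 1) := by
      refine (Finsupp.mem_supported _ _).2 fun l hl => ?_
      obtain ⟨h1, x, hx, hxG⟩ := hsupp l hl
      obtain ⟨h2, -, h3, -⟩ := hc' l h1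
      obtain ⟨h4, h5, -⟩ := h3 ⟨x, hx, hxG⟩
      exact ⟨h2, h4, h5⟩
    have hcV : c + restrict p c ∈ chains V SV (j + 1) := by
      refine (Finsupp.mem_supported _ _).2 fun l hl => ?_
      obtain ⟨h1, h2⟩ := hsupp' l hl
      obtain ⟨h3, -, -, h4, h5⟩ := hc' l h1
      have : {x | x ∈ l} \ G = {x | x ∈ l} := by
        ext x
        exact ⟨fun h => h.1, fun h => ⟨h, fun h' => h2 ⟨x, h, h'⟩⟩⟩
      rw [this] at h4 h5
      exact ⟨h3, h4, h5⟩
    have hd : bdry (restrict p c) ∈ chains (U ∩ V) T j := by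
      have h1 : bdry (restrict p c) ∈ Finsupp.supported (ZMod 2) (ZMod 2)
          {l : List X | l.length = j ∧ ∃ k ∈ (restrict p c).support, l ⊆ k} := by
        refine map_mem_of_single (s := ((restrict p c).support : Set (List X))) bdry
          (fun k hk => ?_) (by simp [Finsupp.mem_supported])
        rw [bdry_single]
        refine Finsupp.supported_mono (fun l hl => ?_) (bdryList_mem k)
        refine ⟨?_, k, hk, hl.1.subset⟩
        have := hl.2
        have := (hc' k (hsupp k hk).1).1
        omega
      have h2 : bdry (c + restrict p c) ∈ Finsupp.supported (ZMod 2) (ZMod 2)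
          {l : List X | ¬ p l} := by
        refine map_mem_of_single (s := ((c + restrict p c).support : Set (List X))) bdry
          (fun k hk => ?_) (by simp [Finsupp.mem_supported])
        rw [bdry_single]
        refine Finsupp.supported_mono (fun l hl => ?_) (bdryList_mem k)
        exact fun ⟨x, hx, hxG⟩ => (hsupp' k hk).2 ⟨x, hl.1.subset hx, hxG⟩
      rw [map_add, hc0, zero_add] at h2
      refine (Finsupp.mem_supported _ _).2 fun l hl => ?_
      obtain ⟨h3, k, hk, hlk⟩ := (Finsupp.mem_supported _ _).1 h1 hl
      have h4 : ¬ p l := (Finsupp.mem_supported _ _).1 h2 hl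
      obtain ⟨h5, x, hx, hxG⟩ := hsupp k hk
      obtain ⟨-, -, h6, h7, -⟩ := hc' k h5
      obtain ⟨h8, -, h9⟩ := h6 ⟨x, hx, hxG⟩
      have h10 : ∀ y ∈ l, y ∈ {x | x ∈ k} \ G := fun y hy => ⟨hlk hy, fun h => h4 ⟨y, hy, h⟩⟩
      exact ⟨h3, fun y hy => ⟨h8 (hlk hy), h7 (h10 y hy)⟩, hT.mono h9 h10⟩
    refine ⟨hd, bdry_bdry _, ?_⟩
    rintro ⟨b, hb, hbd⟩
    have e' := ZModModule.add_self b
    have e'' := ZModModule.add_self (bdry b)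
    have h1 := aU (restrict p c + b) (Submodule.add_mem _ hcU
      (chains_mono Set.inter_subset_left Set.inter_subset_left _ hb)) (by
        rw [map_add, hbd]; exact ZModModule.add_self _)
    have h2 := aV (c + restrict p c + b) (Submodule.add_mem _ hcV
      (chains_mono Set.inter_subset_right Set.inter_subset_right _ hb)) (by
        rw [map_add, map_add, hc0, hbd, zero_add]; exact ZModModule.add_self _)
    have h3 := (h1.mono Set.subset_union_left subset_rfl).add
      (h2.mono Set.subset_union_right subset_rfl)
    have : restrict p c + b + (c + restrict p c + b) = c := by grind
    rwa [this] at h3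

end Small

/-! ### Punctured spaces -/

section Punctured

theorem eq_smul_nil {X : Type*} {U : Set X} {S : Set (Set X)} {c : Chain X}
    (hc : c ∈ chains U S 0) : c = c [] • Finsupp.single [] 1 := by
  ext l
  by_cases hl : l = []
  · simp [hl]
  · rw [Finsupp.smul_apply, Finsupp.single_apply, if_neg (Ne.symm hl), smul_zero]
    by_contra h
    exact hl (List.length_eq_zero_iff.1
      ((Finsupp.mem_supported _ _).1 hc (Finsupp.mem_support_iff.2 h)).1)

theorem rankLEOne_zero {X : Type*} [TopologicalSpace X] (U : Set X) : RankLEOne U 0 := by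
  have key : ∀ c ∈ chains U Set.univ 0, c = 0 ∨ c = Finsupp.single [] 1 := by
    intro c hc
    rw [eq_smul_nil hc]
    generalize c [] = a
    obtain rfl | rfl : a = 0 ∨ a = 1 := by
      revert a
      decide
    · exact Or.inl (zero_smul _ _)
    · exact Or.inr (one_smul _ _)
  intro S hS
  have h0 : Bounds U S 0 0 := ⟨0, Submodule.zero_mem _, map_zero _⟩
  refine ⟨Set.univ, isGauge_univ U, fun c hc c' hc' _ _ => ?_⟩
  obtain rfl | rfl := key c hc
  · exact Or.inl h0
  · obtain rfl | rfl := key c' hc'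
    · exact Or.inr (Or.inl h0)
    · exact Or.inr (Or.inr (by rwa [ZModModule.add_self]))

theorem bounds_nil {X : Type*} [TopologicalSpace X] {U : Set X} {S : Set (Set X)}
    (hS : IsGauge U S) (hU : U.Nonempty) : Bounds U S 0 (Finsupp.single [] 1) := by
  obtain ⟨x, hx⟩ := hU
  obtain ⟨N, hN, hNS⟩ := hS.exists_nhds x hx
  refine ⟨Finsupp.single [x] 1, single_mem_chains ⟨rfl, by simpa using hx, hS.mono hNS ?_⟩,
    by simp [bdryList]⟩
  simpa using mem_of_mem_nhdsWithin hx hN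

theorem acyclic_zero {X : Type*} [TopologicalSpace X] {U : Set X} (hU : U.Nonempty) :
    Acyclic U 0 := by
  intro S hS
  refine ⟨Set.univ, isGauge_univ U, fun c hc _ => ?_⟩
  obtain ⟨b, hb, hbd⟩ := bounds_nil hS hU
  exact ⟨c [] • b, Submodule.smul_mem _ _ hb, by rw [map_smul, hbd, ← eq_smul_nil hc]⟩

/-- The complement of a closed half-line. -/
def slit (m : ℕ) (σ : ℝ) : Set (Fin (m + 1) → ℝ) := {x | 0 < σ * x 0 ∨ Fin.tail x ≠ 0}

theorem isOpen_slit (m : ℕ) (σ : ℝ) : IsOpen (slit m σ) := by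
  refine (isOpen_lt continuous_const (continuous_const.mul (continuous_apply 0))).union ?_
  refine isOpen_ne_fun ?_ continuous_const
  exact continuous_pi fun i => continuous_apply i.succ

theorem acyclic_slit (m : ℕ) {σ : ℝ} (hσ : σ ≠ 0) (j : ℕ) : Acyclic (slit m σ) j := by
  have hσ' : 0 < σ * σ := mul_self_pos.2 hσ
  refine acyclic_of_contraction (P := unitInterval) (s := 0) (t := 1) (e := Pi.single 0 σ)
    (fun t x => (1 - (t : ℝ)) • x + (t : ℝ) • Pi.single 0 σ) ?_ ?_ (Or.inl (by simpa using hσ'))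
    (by simp) (by simp) j
  · fun_prop
  · intro t x hx
    have ht := t.2.1
    obtain ht' | ht' := t.2.2.lt_or_eq
    · by_cases h : Fin.tail x = 0
      · left
        have h1 : 0 < σ * x 0 := hx.resolve_right (by simpa using h)
        simp only [Pi.add_apply, Pi.smul_apply, smul_eq_mul, Pi.single_eq_same]
        nlinarith [mul_pos (sub_pos.2 ht') h1, mul_nonneg ht hσ'.le]
      · right
        intro h'
        refine h (funext fun i => ?_)
        have h2 := congrFun h' i
        simp only [Fin.tail, Pi.add_apply, Pi.smul_apply, smul_eq_mul, ne_eq, Fin.succ_ne_zero,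
          not_false_eq_true, Pi.single_eq_of_ne, mul_zero, add_zero, Pi.zero_apply,
          mul_eq_zero] at h2
        exact h2.resolve_left (sub_ne_zero.2 ht'.ne')
    · left
      simpa [ht'] using hσ'

theorem reduces_tail (m j : ℕ) : Reduces {x : Fin (m + 1) → ℝ | Fin.tail x ≠ 0} j
    ({0}ᶜ : Set (Fin m → ℝ)) j (push Fin.tail) := by
  have hc : Continuous (fun q : ℝ × (Fin m → ℝ) => (Fin.cons q.1 q.2 : Fin (m + 1) → ℝ)) := by
    refine continuous_pi fun i => ?_
    induction i using Fin.cases with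
    | zero => simpa using continuous_fst
    | succ i => simpa using (by fun_prop : Continuous fun q : ℝ × (Fin m → ℝ) => q.2 i)
  have ht : Continuous (Fin.tail : (Fin (m + 1) → ℝ) → Fin m → ℝ) :=
    continuous_pi fun i => continuous_apply i.succ
  refine reduces_of_homotopy (P := unitInterval) (s := 1) (t := 0)
    (U := {x : Fin (m + 1) → ℝ | Fin.tail x ≠ 0}) (V := {0}ᶜ) (g := Fin.tail)
    (h := fun y => Fin.cons 0 y)
    ht.continuousOn
    (hc.comp (by fun_prop : Continuous fun y : Fin m → ℝ => ((0 : ℝ), y))).continuousOn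
    (fun x hx => hx) (fun y hy =>
      show Fin.tail (Fin.cons (0 : ℝ) y : Fin (m + 1) → ℝ) ≠ 0 by simpa using hy)
    (fun t x => Fin.cons ((t : ℝ) * x 0) (Fin.tail x)) ?_ ?_ ?_ ?_ j
  · refine (hc.comp (f := fun q : unitInterval × (Fin (m + 1) → ℝ) =>
      ((q.1 : ℝ) * q.2 0, Fin.tail q.2)) ?_).continuousOn
    exact Continuous.prodMk (by fun_prop) (ht.comp continuous_snd)
  · exact fun t x hx => show Fin.tail (Fin.cons _ _) ≠ 0 by simpa using hx
  · exact fun x _ => by simp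
  · exact fun x _ => by simp

theorem eq_zero_of_tail {m : ℕ} {x : Fin (m + 1) → ℝ} (h : x 0 = 0) (h' : Fin.tail x = 0) :
    x = 0 := by
  rw [← Fin.cons_self_tail x, h, h']
  exact funext (Fin.cases rfl fun _ => rfl)

/-- The suspension isomorphism for punctured spaces. -/
theorem exists_reduces_punctured (m j : ℕ) :
    ∃ L, Reduces ({0}ᶜ : Set (Fin (m + 1) → ℝ)) (j + 1) (slit m 1 ∩ slit m (-1)) j L := by
  have e : ({0}ᶜ : Set (Fin (m + 1) → ℝ)) = slit m 1 ∪ slit m (-1) := by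
    ext x
    simp only [Set.mem_compl_iff, Set.mem_singleton_iff, slit, Set.mem_union, Set.mem_ofPred_eq]
    constructor
    · intro h
      by_contra! h'
      exact h (eq_zero_of_tail (by linarith [h'.1.1, h'.2.1]) h'.1.2)
    · rintro h rfl
      have : Fin.tail (0 : Fin (m + 1) → ℝ) = 0 := rfl
      simp [this] at h
  rw [e]
  refine ⟨_, reduces_mayerVietoris (G := {x | 0 < x 0}) (isOpen_slit m 1) (isOpen_slit m (-1))
    ?_ ?_ (acyclic_slit m one_ne_zero _) (acyclic_slit m (by norm_num) _)⟩
  · rintro x ⟨h1, h2⟩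
    simp only [slit, Set.mem_ofPred_eq, not_or, not_not] at h1 h2
    refine (isOpen_lt continuous_const (continuous_apply 0)).mem_nhds ?_
    simpa using h1.resolve_right (by simpa using h2.2)
  · rintro x ⟨h1, h2⟩
    simp only [slit, Set.mem_ofPred_eq, not_or, not_not] at h1 h2
    have h3 : x 0 < 0 := by simpa using h1.resolve_right (by simpa using h2.2)
    filter_upwards [(isOpen_lt (continuous_apply 0) continuous_const).mem_nhds h3] with y hy
    exact not_lt.2 (le_of_lt hy)

theorem slit_inter (m : ℕ) :
    slit m 1 ∩ slit m (-1) = {x : Fin (m + 1) → ℝ | Fin.tail x ≠ 0} := by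
  ext x
  simp only [slit, Set.mem_inter_iff, Set.mem_ofPred_eq]
  constructor
  · rintro ⟨h1 | h1, h2 | h2⟩
    · linarith
    all_goals assumption
  · exact fun h => ⟨Or.inr h, Or.inr h⟩

theorem acyclic_punctured {m j : ℕ} (h : j < m) : Acyclic ({0}ᶜ : Set (Fin m → ℝ)) j := by
  induction m generalizing j with
  | zero => omega
  | succ m ih =>
    cases j with
    | zero => exact acyclic_zero ⟨fun _ => 1, fun h => by simpa using congrFun h 0⟩
    | succ j =>
      obtain ⟨L, hL⟩ := exists_reduces_punctured m j
      refine hL.acyclic ?_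
      rw [slit_inter]
      exact (reduces_tail m j).acyclic (ih (by omega))

theorem rankLEOne_punctured (m : ℕ) : RankLEOne ({0}ᶜ : Set (Fin m → ℝ)) m := by
  induction m with
  | zero => exact rankLEOne_zero _
  | succ m ih =>
    obtain ⟨L, hL⟩ := exists_reduces_punctured m m
    refine hL.rankLEOne ?_
    rw [slit_inter]
    exact (reduces_tail m m).rankLEOne ih

/-- The complement of a closed ball. -/
def outer (m : ℕ) (ρ : ℝ) : Set (Fin m → ℝ) := {x | ρ < ‖x‖}

theorem outer_subset {m : ℕ} {ρ : ℝ} (hρ : 0 ≤ ρ) : outer m ρ ⊆ {0}ᶜ := by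
  rintro x hx rfl
  simp [outer] at hx
  linarith

theorem reduces_outer (m : ℕ) {ρ : ℝ} (hρ : 0 ≤ ρ) (j : ℕ) :
    Reduces (outer m ρ) j ({0}ᶜ : Set (Fin m → ℝ)) j (push id) := by
  have hn : ∀ x : Fin m → ℝ, x ≠ 0 → ∀ t : ℝ, 0 ≤ t →
      ‖x + (t * ρ / ‖x‖) • x‖ = ‖x‖ + t * ρ := by
    intro x hx t ht
    have hx' : 0 < ‖x‖ := norm_pos_iff.2 hx
    have : x + (t * ρ / ‖x‖) • x = (1 + t * ρ / ‖x‖) • x := by rw [add_smul, one_smul]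
    rw [this, norm_smul, Real.norm_of_nonneg (by positivity)]
    field_simp
  refine reduces_of_homotopy (P := unitInterval) (s := 0) (t := 1) (g := id)
    (h := fun x => x + (1 * ρ / ‖x‖) • x) continuousOn_id ?_ (outer_subset hρ) ?_
    (fun t x => x + ((t : ℝ) * ρ / ‖x‖) • x) ?_ ?_ ?_ ?_ j
  · intro x hx
    have : ‖x‖ ≠ 0 := norm_ne_zero_iff.2 hx
    exact ContinuousAt.continuousWithinAt (by fun_prop (disch := assumption))
  · intro x hx
    show ρ < ‖_‖
    rw [hn x hx 1 zero_le_one]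
    linarith [norm_pos_iff.2 hx]
  · rintro ⟨t, x⟩ ⟨-, hx⟩
    have : ‖x‖ ≠ 0 := norm_ne_zero_iff.2 (outer_subset hρ hx)
    exact ContinuousAt.continuousWithinAt (by fun_prop (disch := assumption))
  · intro t x hx
    show ρ < ‖_‖
    rw [hn x (outer_subset hρ hx) t t.2.1]
    have : ρ < ‖x‖ := hx
    nlinarith [t.2.1, mul_nonneg t.2.1 hρ]
  · simp
  · simp

theorem push_id {X : Type*} (c : Chain X) : push id c = c :=
  linearMap_ext (L := push id) (L' := LinearMap.id) (fun l => by simp) c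

theorem acyclic_outer {m : ℕ} {ρ : ℝ} (hρ : 0 ≤ ρ) {j : ℕ} (h : j < m) :
    Acyclic (outer m ρ) j :=
  (reduces_outer m hρ j).acyclic (acyclic_punctured h)

end Punctured

/-! ### Smith sequences of an involution -/

section Smith

variable {X : Type*}

/-- A sequence of small chains up to dimension `k` in which the boundary of each term is the
symmetrization of the previous one, starting with an odd number of points. -/
structure IsSmith (τ : X → X) (U : Set X) (S : Set (Set X)) (k : ℕ) (c : ℕ → Chain X) : Prop where
  mem : ∀ i ≤ k, c i ∈ chains U S (i + 1)
  zero : bdry (c 0) = Finsupp.single [] 1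
  succ : ∀ i < k, bdry (c (i + 1)) = c i + push τ (c i)

theorem IsSmith.mono {τ : X → X} {U V : Set X} {S T : Set (Set X)} {k : ℕ} {c : ℕ → Chain X}
    (h : IsSmith τ U S k c) (hUV : U ⊆ V) (hST : S ⊆ T) : IsSmith τ V T k c :=
  ⟨fun i hi => chains_mono hUV hST _ (h.mem i hi), h.zero, h.succ⟩

theorem IsSmith.pred {τ : X → X} {U : Set X} {S : Set (Set X)} {k : ℕ} {c : ℕ → Chain X}
    (h : IsSmith τ U S (k + 1) c) : IsSmith τ U S k c :=
  ⟨fun i hi => h.mem i (by omega), h.zero, fun i hi => h.succ i (by omega)⟩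

theorem IsSmith.bdry_symm {τ : X → X} (hτ : Function.Involutive τ) {U : Set X} {S : Set (Set X)}
    {k : ℕ} {c : ℕ → Chain X} (h : IsSmith τ U S k c) : bdry (c k + push τ (c k)) = 0 := by
  rw [map_add, bdry_push]
  cases k with
  | zero => simp [h.zero, ZModModule.add_self]
  | succ k =>
    rw [h.succ k (by omega), map_add, push_push_of_involutive hτ, add_comm (push τ (c k))]
    exact ZModModule.add_self _

theorem exists_mapsTo_outer {m : ℕ} {τ : (Fin m → ℝ) → Fin m → ℝ} (hc : Continuous τ)
    (hτ : Function.Involutive τ) (ρ : ℝ) :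
    ∃ ρ' ≥ ρ, Set.MapsTo τ (outer m ρ') (outer m ρ) := by
  obtain ⟨C, hC⟩ := (((isCompact_closedBall (0 : Fin m → ℝ) ρ).image hc).isBounded).exists_norm_le
  refine ⟨max ρ C, le_max_left _ _, fun x hx => ?_⟩
  by_contra h
  have h1 : ‖τ x‖ ≤ ρ := not_lt.1 h
  have h2 : ‖x‖ ≤ C := hC x ⟨τ x, by simpa using h1, hτ x⟩
  exact absurd hx (not_lt.2 (h2.trans (le_max_right _ _)))

theorem outer_mono {m : ℕ} {ρ ρ' : ℝ} (h : ρ ≤ ρ') : outer m ρ' ⊆ outer m ρ :=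
  fun _ hx => lt_of_le_of_lt h hx

theorem symm_mem {τ : X → X} {U V : Set X} {S : Set (Set X)} (h : U ⊆ V) (hτ : Set.MapsTo τ U V)
    {j : ℕ} {c : Chain X} (hc : c ∈ chains U (S ∩ {A | τ '' A ∈ S}) j) :
    c + push τ c ∈ chains V S j :=
  Submodule.add_mem _ (chains_mono h Set.inter_subset_left _ hc)
    (push_mem hτ (chains_mono subset_rfl Set.inter_subset_right _ hc))

theorem exists_isSmith {m : ℕ} {τ : (Fin m → ℝ) → Fin m → ℝ} (hc : Continuous τ)
    (hτ : Function.Involutive τ) {k : ℕ} (hk : k < m) {ρ : ℝ} (hρ : 0 ≤ ρ)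
    {S : Set (Set (Fin m → ℝ))} (hS : IsGauge (outer m ρ) S) :
    ∃ c, IsSmith τ (outer m ρ) S k c := by
  induction k generalizing ρ S with
  | zero =>
    have hne : (outer m ρ).Nonempty := by
      refine ⟨fun _ => ρ + 1, ?_⟩
      have : Nonempty (Fin m) := ⟨⟨0, hk⟩⟩
      show ρ < ‖_‖
      rw [pi_norm_const, Real.norm_of_nonneg (by linarith)]
      linarith
    obtain ⟨b, hb, hbd⟩ := bounds_nil hS hne
    exact ⟨fun _ => b, fun i hi => by rwa [Nat.le_zero.1 hi], hbd, fun i hi => by omega⟩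
  | succ k ih =>
    obtain ⟨T, hT, hB⟩ := acyclic_outer hρ hk S hS
    obtain ⟨ρ', hρ', hmaps⟩ := exists_mapsTo_outer hc hτ ρ
    have hsub : outer m ρ' ⊆ outer m ρ := outer_mono hρ'
    obtain ⟨c, h⟩ := ih (by omega) (hρ.trans hρ')
      ((hS.subset hsub).inter ((hT.subset hsub).inter (hT.comap hc.continuousOn hmaps)))
    obtain ⟨b, hb, hbd⟩ := hB _ (symm_mem hsub hmaps
      (chains_mono subset_rfl Set.inter_subset_right _ (h.mem k le_rfl))) (h.bdry_symm hτ)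
    refine ⟨Function.update c (k + 1) b, fun i hi => ?_, ?_, fun i hi => ?_⟩
    · obtain rfl | hi' := eq_or_ne i (k + 1)
      · simpa using hb
      · rw [Function.update_of_ne hi']
        exact chains_mono hsub Set.inter_subset_left _ (h.mem i (by omega))
    · rw [Function.update_of_ne (by omega)]
      exact h.zero
    · rw [Function.update_of_ne (show i ≠ k + 1 by omega)]
      obtain rfl | hi' := eq_or_ne i k
      · simpa using hbd
      · rw [Function.update_of_ne (by omega)]
        exact h.succ i (by omega)

/-- A second fixed point makes the symmetrization of the last term of a Smith sequence the
symmetrization of a cycle. -/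
theorem exists_gauge_cycle {m : ℕ} {τ : (Fin m → ℝ) → Fin m → ℝ} (hc : Continuous τ)
    (hτ : Function.Involutive τ) (hmaps : Set.MapsTo τ {0}ᶜ {0}ᶜ) {q : Fin m → ℝ} (hq : q ≠ 0)
    (hτq : τ q = q) {k : ℕ} (hk : k < m) {S : Set (Set (Fin m → ℝ))} (hS : IsGauge {0}ᶜ S) :
    ∃ T, IsGauge {0}ᶜ T ∧ ∀ c, IsSmith τ {0}ᶜ T k c → ∃ y ∈ chains {0}ᶜ S (k + 1),
      bdry y = 0 ∧ y + push τ y = c k + push τ (c k) := by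
  induction k generalizing S with
  | zero =>
    refine ⟨S, hS, fun c h => ⟨c 0 + Finsupp.single [q] 1, ?_, ?_, ?_⟩⟩
    · refine Submodule.add_mem _ (h.mem 0 le_rfl) (single_mem_chains ⟨rfl, by simpa using hq, ?_⟩)
      obtain ⟨N, hN, hNS⟩ := hS.exists_nhds q hq
      exact hS.mono hNS (by simpa using mem_of_mem_nhdsWithin hq hN)
    · simp [h.zero, bdryList, ZModModule.add_self]
    · have e := ZModModule.add_self (Finsupp.single [q] (1 : ZMod 2))
      rw [map_add, push_single, List.map_singleton, hτq]
      grind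
  | succ k ih =>
    obtain ⟨T, hT, hB⟩ := acyclic_punctured hk _ (hS.inter (hS.comap hc.continuousOn hmaps))
    obtain ⟨T', hT', ih⟩ := ih (by omega) hT
    refine ⟨S ∩ T', hS.inter hT', fun c h => ?_⟩
    obtain ⟨y, hy, hy0, hyc⟩ := ih c (h.pred.mono subset_rfl Set.inter_subset_right)
    obtain ⟨b, hb, rfl⟩ := hB y hy hy0
    refine ⟨c (k + 1) + (b + push τ b), Submodule.add_mem _ ?_ (symm_mem subset_rfl hmaps hb),
      ?_, ?_⟩
    · exact chains_mono subset_rfl Set.inter_subset_left _ (h.mem (k + 1) le_rfl)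
    · rw [map_add, map_add, bdry_push, hyc, h.succ k (by omega)]
      exact ZModModule.add_self _
    · have e := ZModModule.add_self b
      have e' := ZModModule.add_self (push τ b)
      rw [map_add, map_add, push_push_of_involutive hτ]
      grind

theorem exists_gauge_bounds {k : ℕ} {τ : (Fin (k + 1) → ℝ) → Fin (k + 1) → ℝ} (hc : Continuous τ)
    (hτ : Function.Involutive τ) (hmaps : Set.MapsTo τ {0}ᶜ {0}ᶜ) {q : Fin (k + 1) → ℝ}
    (hq : q ≠ 0) (hτq : τ q = q) {S : Set (Set (Fin (k + 1) → ℝ))} (hS : IsGauge {0}ᶜ S) :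
    ∃ T, IsGauge {0}ᶜ T ∧ ∀ c, IsSmith τ {0}ᶜ T k c →
      Bounds {0}ᶜ S (k + 1) (c k + push τ (c k)) := by
  obtain ⟨T, hT, hB⟩ := rankLEOne_punctured (k + 1) _
    (hS.inter (hS.comap hc.continuousOn hmaps))
  obtain ⟨T', hT', hy⟩ := exists_gauge_cycle hc hτ hmaps hq hτq (Nat.lt_succ_self k)
    (hT.inter (hT.comap hc.continuousOn hmaps))
  refine ⟨T', hT', fun c h => ?_⟩
  obtain ⟨y, hy, hy0, hyc⟩ := hy c h
  rw [← hyc]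
  obtain ⟨b, hb, hbd⟩ | ⟨b, hb, hbd⟩ | h3 := hB y
    (chains_mono subset_rfl Set.inter_subset_left _ hy) (push τ y)
    (push_mem hmaps (chains_mono subset_rfl Set.inter_subset_right _ hy)) hy0
    (by rw [bdry_push, hy0, map_zero])
  · exact ⟨b + push τ b, symm_mem subset_rfl hmaps hb, by rw [map_add, bdry_push, hbd]⟩
  · refine ⟨b + push τ b, symm_mem subset_rfl hmaps hb, ?_⟩
    rw [map_add, bdry_push, hbd, push_push_of_involutive hτ]
    exact add_comm _ _
  · exact h3.mono subset_rfl Set.inter_subset_left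

/-- An involution with two fixed points has arbitrarily fine Smith sequences near infinity whose
last symmetrization bounds there. -/
theorem exists_isSmith_bounds {k : ℕ} {τ : (Fin (k + 1) → ℝ) → Fin (k + 1) → ℝ}
    (hc : Continuous τ) (hτ : Function.Involutive τ) (h0 : τ 0 = 0) {q : Fin (k + 1) → ℝ}
    (hq : q ≠ 0) (hτq : τ q = q) {ρ : ℝ} (hρ : 0 ≤ ρ) {S : Set (Set (Fin (k + 1) → ℝ))}
    (hS : IsGauge (outer (k + 1) ρ) S) :
    ∃ c, IsSmith τ (outer (k + 1) ρ) S k c ∧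
      Bounds (outer (k + 1) ρ) S (k + 1) (c k + push τ (c k)) := by
  have hmaps : Set.MapsTo τ {0}ᶜ {0}ᶜ := fun x hx h =>
    hx (by rw [Set.mem_singleton_iff, ← hτ x, Set.mem_singleton_iff.1 h, h0])
  obtain ⟨T, hT, hR⟩ := reduces_outer (k + 1) hρ (k + 1) S hS
  obtain ⟨T', hT', hR⟩ := hR _ (isGauge_univ _)
  obtain ⟨T'', hT'', hB⟩ := exists_gauge_bounds hc hτ hmaps hq hτq hT
  obtain ⟨ρ', hρ', hmaps'⟩ := exists_mapsTo_outer hc hτ ρ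
  have hsub : outer (k + 1) ρ' ⊆ outer (k + 1) ρ := outer_mono hρ'
  obtain ⟨c, h⟩ := exists_isSmith hc hτ (Nat.lt_succ_self k) (hρ.trans hρ')
    (((hS.subset hsub).inter (hT''.subset (outer_subset (hρ.trans hρ')))).inter
      ((hT'.subset hsub).inter (hT'.comap hc.continuousOn hmaps')))
  refine ⟨c, h.mono hsub fun A hA => hA.1.1, ?_⟩
  obtain ⟨-, -, h3⟩ := hR _ (symm_mem hsub hmaps'
    (chains_mono subset_rfl Set.inter_subset_right _ (h.mem k le_rfl))) (h.bdry_symm hτ)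
  refine h3 ?_
  rw [push_id]
  exact hB c (h.mono (outer_subset (hρ.trans hρ')) fun A hA => hA.1.2)

end Smith

/-! ### Labels and the Ky Fan cochains -/

section Label

/-- The cochain with given values on lists, as a linear functional on chains. -/
def ev {X : Type*} (φ : List X → ZMod 2) : Chain X →ₗ[ZMod 2] ZMod 2 :=
  Finsupp.linearCombination (ZMod 2) φ

@[simp] theorem ev_single {X : Type*} (φ : List X → ZMod 2) (l : List X) :
    ev φ (Finsupp.single l 1) = φ l := by
  simp [ev]

theorem ev_cone {X : Type*} (φ : List X → ZMod 2) (x : X) (c : Chain X) :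
    ev φ (cone x c) = ev (fun l => φ (x :: l)) c :=
  linearMap_ext (L := ev φ ∘ₗ cone x) (L' := ev fun l => φ (x :: l)) (fun l => by simp) c

theorem ev_bdryList_perm {X : Type*} {l l' : List X} (h : l.Perm l') (φ : List X → ZMod 2)
    (hφ : ∀ k k', k.Perm k' → φ k = φ k') : ev φ (bdryList l) = ev φ (bdryList l') := by
  induction h generalizing φ with
  | nil => rfl
  | cons x h ih =>
    simp only [bdryList, map_add, ev_single, ev_cone]
    rw [hφ _ _ h, ih _ fun k k' hk => hφ _ _ (hk.cons x)]
  | swap x y l =>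
    simp only [bdryList, map_add, ev_single, ev_cone, cone_single]
    have : (fun k => φ (x :: y :: k)) = fun k => φ (y :: x :: k) :=
      funext fun k => hφ _ _ (List.Perm.swap y x k)
    rw [this]
    ring
  | trans _ _ h h' => rw [h φ hφ, h' φ hφ]

theorem ev_congr {X : Type*} {φ ψ : List X → ZMod 2} {s : Set (List X)} {c : Chain X}
    (hc : c ∈ Finsupp.supported (ZMod 2) (ZMod 2) s) (h : ∀ l ∈ s, φ l = ψ l) : ev φ c = ev ψ c :=
  eq_of_eq_on_single (ev φ) (ev ψ) (fun l hl => by simpa using h l hl) hc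

/-- A label `n` is an index `n / 2` together with a sign `n % 2`; a list alternates if its indices
increase and its signs alternate, starting with the parity of `s`. -/
def Alternates : ℕ → List ℕ → Prop
  | _, [] => True
  | s, x :: l => x % 2 = s % 2 ∧ (∀ y ∈ l, x / 2 < y / 2) ∧ Alternates (s + 1) l

/-- Reversing the sign of a label. -/
def flip (n : ℕ) : ℕ := if n % 2 = 0 then n + 1 else n - 1

theorem flip_div (n : ℕ) : flip n / 2 = n / 2 := by
  unfold flip
  split <;> omega

theorem flip_mod (n : ℕ) : flip n % 2 = (n + 1) % 2 := by
  unfold flip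
  split <;> omega

theorem alternates_congr {s t : ℕ} (h : s % 2 = t % 2) (l : List ℕ) :
    Alternates s l ↔ Alternates t l := by
  induction l generalizing s t with
  | nil => exact Iff.rfl
  | cons x l ih =>
    unfold Alternates
    rw [h, ih (show (s + 1) % 2 = (t + 1) % 2 by omega)]

theorem alternates_map_flip (s : ℕ) (l : List ℕ) :
    Alternates s (l.map flip) ↔ Alternates (s + 1) l := by
  induction l generalizing s with
  | nil => exact Iff.rfl
  | cons x l ih =>
    simp only [List.map_cons, Alternates, List.mem_map, forall_exists_index, and_imp,
      forall_apply_eq_imp_iff₂, flip_div, flip_mod, ih]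
    rw [show (x + 1) % 2 = s % 2 ↔ x % 2 = (s + 1) % 2 by omega]

open Classical in
/-- The indicator of alternating lists. -/
def alt (s : ℕ) (l : List ℕ) : ZMod 2 := if Alternates s l then 1 else 0

theorem alt_eq_of_iff {s t : ℕ} {l k : List ℕ} (h : Alternates s l ↔ Alternates t k) :
    alt s l = alt t k := by
  unfold alt
  split_ifs <;> tauto

theorem alt_congr {s t : ℕ} (h : s % 2 = t % 2) (l : List ℕ) : alt s l = alt t l :=
  alt_eq_of_iff (alternates_congr h l)

/-- No two labels in the list are opposite. -/
def Coherent (l : List ℕ) : Prop := ∀ x ∈ l, ∀ y ∈ l, x / 2 = y / 2 → x = y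

theorem Coherent.subset {l l' : List ℕ} (h : Coherent l) (h' : l' ⊆ l) : Coherent l' :=
  fun x hx y hy => h x (h' hx) y (h' hy)

theorem alt_cons_of_ne {s x : ℕ} (h : x % 2 ≠ s % 2) (l : List ℕ) : alt s (x :: l) = 0 := by
  simp [alt, Alternates, h]

theorem alt_cons_of_eq {s x : ℕ} (h : x % 2 = s % 2) {l : List ℕ} (hl : ∀ y ∈ l, x / 2 < y / 2) :
    alt s (x :: l) = alt (s + 1) l :=
  alt_eq_of_iff ⟨fun h' => h'.2.2, fun h' => ⟨h, hl, h'⟩⟩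

theorem alt_cons_cons_self (s x : ℕ) (l : List ℕ) : alt s (x :: x :: l) = 0 := by
  simp [alt, Alternates]

theorem ev_alt_bdryList (s : ℕ) {l : List ℕ} (hl : l.Pairwise (· ≤ ·)) (h : Coherent l) :
    ev (alt s) (bdryList l) = alt s l + alt (s + 1) l := by
  induction l generalizing s with
  | nil => simp [bdryList, alt, Alternates, CharTwo.add_self_eq_zero]
  | cons x l ih =>
    rw [List.pairwise_cons] at hl
    have h' : Coherent l := h.subset (List.subset_cons_self x l)
    have key : (∀ y ∈ l, x / 2 < y / 2) ∨ ∃ k, l = x :: k := by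
      cases l with
      | nil => simp
      | cons y k =>
        have hxy := hl.1 y (by simp)
        obtain h1 | h1 := (Nat.div_le_div_right (c := 2) hxy).lt_or_eq
        · left
          intro z hz
          obtain rfl | hz := List.mem_cons.1 hz
          · exact h1
          · exact h1.trans_le (Nat.div_le_div_right ((List.pairwise_cons.1 hl.2).1 z hz))
        · right
          exact ⟨k, by rw [h x (by simp) y (by simp) h1]⟩
    simp only [bdryList, map_add, ev_single, ev_cone]
    obtain key | ⟨k, rfl⟩ := key
    · by_cases hs : x % 2 = s % 2
      · rw [alt_cons_of_ne (s := s + 1) (by omega), alt_cons_of_eq hs key, add_zero]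
        have : ev (fun k => alt s (x :: k)) (bdryList l) = ev (alt (s + 1)) (bdryList l) :=
          ev_congr (bdryList_mem l) fun k hk =>
            alt_cons_of_eq hs fun y hy => key y (hk.1.subset hy)
        rw [this, ih (s + 1) hl.2 h', alt_congr (s := s + 1 + 1) (t := s) (by omega)]
        have e := CharTwo.add_self_eq_zero (alt s l)
        grind
      · rw [alt_cons_of_ne hs, alt_cons_of_eq (s := s + 1) (by omega) key,
          alt_congr (s := s + 1 + 1) (t := s) (by omega)]
        have : ev (fun k => alt s (x :: k)) (bdryList l) = ev 0 (bdryList l) :=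
          ev_congr (bdryList_mem l) fun k _ => alt_cons_of_ne hs k
        rw [this]
        simp [ev]
    · simp only [bdryList, map_add, ev_single, ev_cone, alt_cons_cons_self]
      rw [← add_assoc, CharTwo.add_self_eq_zero]
      have : ev (fun k => alt s (x :: x :: k)) (bdryList k) = ev 0 (bdryList k) :=
        ev_congr (bdryList_mem k) fun k _ => alt_cons_cons_self s x k
      simp only [alt_cons_cons_self] at this
      rw [this]
      simp [ev]

/-- The indicator of lists which alternate after sorting. -/
def fan (s : ℕ) (l : List ℕ) : ZMod 2 := alt s (l.insertionSort (· ≤ ·))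

theorem fan_perm (s : ℕ) {l l' : List ℕ} (h : l.Perm l') : fan s l = fan s l' := by
  unfold fan
  rw [List.Perm.eq_of_pairwise' (List.pairwise_insertionSort (· ≤ ·) l)
    (List.pairwise_insertionSort (· ≤ ·) l')
    (((List.perm_insertionSort _ l).trans h).trans (List.perm_insertionSort _ l').symm)]

theorem fan_of_pairwise (s : ℕ) {l : List ℕ} (h : l.Pairwise (· ≤ ·)) : fan s l = alt s l := by
  unfold fan
  rw [h.insertionSort_eq]

theorem ev_fan_bdryList (s : ℕ) {l : List ℕ} (h : Coherent l) :
    ev (fan s) (bdryList l) = fan s l + fan (s + 1) l := by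
  have hs := List.pairwise_insertionSort (· ≤ ·) l
  have hp := List.perm_insertionSort (· ≤ ·) l
  rw [ev_bdryList_perm hp.symm _ fun k k' hk => fan_perm s hk]
  have : ev (fan s) (bdryList (l.insertionSort (· ≤ ·))) =
      ev (alt s) (bdryList (l.insertionSort (· ≤ ·))) :=
    ev_congr (bdryList_mem _) fun k hk => fan_of_pairwise s (hs.sublist hk.1)
  rw [this, ev_alt_bdryList s hs (h.subset hp.subset)]
  rfl

theorem fan_map_flip (s : ℕ) {l : List ℕ} (h : Coherent l) :
    fan s (l.map flip) = fan (s + 1) l := by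
  have hs := List.pairwise_insertionSort (· ≤ ·) l
  have hp := List.perm_insertionSort (· ≤ ·) l
  have hs' : ((l.insertionSort (· ≤ ·)).map flip).Pairwise (· ≤ ·) := by
    rw [List.pairwise_map]
    refine hs.imp_of_mem fun {a b} ha hb hab => ?_
    have h1 := h a (hp.subset ha) b (hp.subset hb)
    have h2 := flip_div a
    have h3 := flip_div b
    by_cases h4 : a / 2 = b / 2
    · rw [h1 h4]
    · omega
  rw [fan_perm s (hp.map flip).symm, fan_of_pairwise s hs']
  exact alt_eq_of_iff (alternates_map_flip s _)

theorem fan_eq_zero (s : ℕ) {m : ℕ} {l : List ℕ} (h : ∀ x ∈ l, x / 2 < m) (hl : m < l.length) :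
    fan s l = 0 := by
  have key : ∀ (k : List ℕ) (s : ℕ), Alternates s k → (k.map (· / 2)).Nodup := by
    intro k
    induction k with
    | nil => simp
    | cons x k ih =>
      rintro s ⟨-, h1, h2⟩
      rw [List.map_cons, List.nodup_cons]
      refine ⟨fun h3 => ?_, ih _ h2⟩
      obtain ⟨y, hy, hxy⟩ := List.mem_map.1 h3
      exact absurd (h1 y hy) (by omega)
  have hp := List.perm_insertionSort (· ≤ ·) l
  unfold fan alt
  rw [if_neg]
  intro h1
  have h2 := (List.subperm_of_subset (key _ _ h1) (l₂ := List.range m) fun i hi => ?_).length_le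
  · simp at h2
    omega
  · obtain ⟨y, hy, rfl⟩ := List.mem_map.1 hi
    simpa using h y (hp.subset hy)

/-- The Ky Fan obstruction: the last symmetrization of a Smith sequence does not bound if there is
a coherent equivariant labelling with few labels. -/
theorem IsSmith.not_bounds {X : Type*} {τ : X → X} {U : Set X} {S : Set (Set X)} {k : ℕ}
    {c : ℕ → Chain X} (h : IsSmith τ U S k c) (label : X → ℕ)
    (hτ : ∀ x ∈ U, label (τ x) = flip (label x)) (hlt : ∀ x ∈ U, label x / 2 < k + 1)
    (hS : ∀ A ∈ S, ∀ x ∈ A, ∀ y ∈ A, label x / 2 = label y / 2 → label x = label y) :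
    ¬ Bounds U S (k + 1) (c k + push τ (c k)) := by
  set α : ℕ → Chain X →ₗ[ZMod 2] ZMod 2 := fun s => ev (fan s) ∘ₗ push label with hα
  have hcoh : ∀ {j : ℕ}, ∀ l ∈ smallLists U S j, Coherent (l.map label) := by
    intro j l hl x hx y hy hxy
    obtain ⟨x, hx', rfl⟩ := List.mem_map.1 hx
    obtain ⟨y, hy', rfl⟩ := List.mem_map.1 hy
    exact hS _ hl.2.2 x hx' y hy' hxy
  have h1 : ∀ {j : ℕ} {b : Chain X}, b ∈ chains U S j → α 0 (bdry b) = α 0 b + α 1 b := by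
    intro j b hb
    refine eq_of_eq_on_single (α 0 ∘ₗ bdry) (α 0 + α 1) (fun l hl => ?_) hb
    simp only [hα, LinearMap.comp_apply, bdry_single, LinearMap.add_apply, push_single, ev_single,
      push_bdryList]
    exact ev_fan_bdryList 0 (hcoh l hl)
  have h2 : ∀ {j : ℕ} {b : Chain X}, b ∈ chains U S j → α 0 (push τ b) = α 1 b := by
    intro j b hb
    refine eq_of_eq_on_single (α 0 ∘ₗ push τ) (α 1) (fun l hl => ?_) hb
    simp only [hα, LinearMap.comp_apply, push_single, ev_single]
    have : (l.map τ).map label = (l.map label).map flip := by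
      rw [List.map_map, List.map_map]
      exact List.map_congr_left fun x hx => hτ x (hl.2.1 x hx)
    rw [this]
    exact fan_map_flip 0 (hcoh l hl)
  have h3 : ∀ i ≤ k, α 0 (bdry (c i)) = α 0 (c i + push τ (c i)) := fun i hi => by
    rw [h1 (h.mem i hi), map_add, h2 (h.mem i hi)]
  have h4 : ∀ i ≤ k, α 0 (c i + push τ (c i)) = 1 := by
    intro i
    induction i with
    | zero =>
      intro hi
      rw [← h3 0 hi, h.zero]
      simp [hα, fan, alt, Alternates]
    | succ i ih =>
      intro hi
      rw [← h3 _ hi, h.succ i (by omega), ih (by omega)]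
  rintro ⟨b, hb, hbd⟩
  have h5 := h4 k le_rfl
  rw [← hbd, h1 hb] at h5
  have h6 : ∀ s, α s b = 0 := fun s => by
    refine eq_of_eq_on_single (α s) 0 (fun l hl => ?_) hb
    simp only [hα, LinearMap.comp_apply, push_single, ev_single, LinearMap.zero_apply]
    refine fan_eq_zero s (m := k + 1) (fun x hx => ?_) ?_
    · obtain ⟨y, hy, rfl⟩ := List.mem_map.1 hx
      exact hlt y (hl.2.1 y hy)
    · rw [List.length_map, hl.1]
      omega
  rw [h6, h6] at h5
  simp at h5

end Label

/-! ### Involutions with bounded fixed point set -/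

section FixedPoints

theorem exists_label (k : ℕ) : ∃ label : (Fin (k + 1) → ℝ) → ℕ,
    (∀ x, label x / 2 < k + 1) ∧ (∀ x ≠ 0, label (-x) = flip (label x)) ∧
    ∀ x ≠ 0, ∀ y ∈ Metric.ball x (‖x‖ / 2), ∀ z ∈ Metric.ball x (‖x‖ / 2),
      label y / 2 = label z / 2 → label y = label z := by
  choose top htop using fun a : Fin (k + 1) → ℝ => Finite.exists_max a
  set i : (Fin (k + 1) → ℝ) → Fin (k + 1) := fun x => top fun j => |x j| with hi
  have hin : ∀ x : Fin (k + 1) → ℝ, |x (i x)| = ‖x‖ := fun x => by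
    refine le_antisymm (norm_le_pi_norm x _) ((pi_norm_le_iff_of_nonneg (abs_nonneg _)).2 ?_)
    exact htop fun j => |x j|
  have hneg : ∀ x, i (-x) = i x := fun x => by simp [hi]
  have hdiv : ∀ x : Fin (k + 1) → ℝ, (2 * (i x : ℕ) + if 0 < x (i x) then 0 else 1) / 2 = (i x : ℕ) := by
    intro x
    split_ifs <;> omega
  refine ⟨fun x => 2 * i x + if 0 < x (i x) then 0 else 1, fun x => ?_, fun x hx => ?_, ?_⟩
  · rw [hdiv]
    exact (i x).2
  · have h0 : x (i x) ≠ 0 := by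
      rw [← abs_ne_zero, hin]
      exact norm_ne_zero_iff.2 hx
    simp only [hneg, Pi.neg_apply, flip]
    obtain h | h := lt_or_gt_of_ne h0
    · rw [if_pos (by linarith), if_neg (show ¬ 0 < x (i x) by linarith), if_neg (by omega)]
      omega
    · rw [if_neg (by linarith), if_pos h, if_pos (by omega)]
  · intro x hx y hy z hz h
    simp only [hdiv] at h
    have hyz : i y = i z := Fin.ext h
    rw [mem_ball_iff_norm] at hy hz
    have key : ∀ w, ‖w - x‖ < ‖x‖ / 2 → ‖x‖ / 2 < |w (i w)| := fun w hw => by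
      rw [hin]
      have := norm_sub_norm_le x w
      rw [norm_sub_rev] at this
      linarith
    have hy' := key y hy
    have hz' := key z hz
    have h1 : |y (i y) - z (i y)| < ‖x‖ := by
      have h2 : y (i y) - z (i y) = (y - x) (i y) - (z - x) (i y) := by simp
      have h3 := abs_sub ((y - x) (i y)) ((z - x) (i y))
      have h4 : |(y - x) (i y)| ≤ ‖y - x‖ := norm_le_pi_norm (y - x) (i y)
      have h5 : |(z - x) (i y)| ≤ ‖z - x‖ := norm_le_pi_norm (z - x) (i y)
      rw [h2]
      linarith
    rw [← hyz] at hz'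
    simp only [← hyz]
    rw [abs_lt] at h1
    rw [lt_abs] at hy' hz'
    have hx' := norm_pos_iff.2 hx
    have : 0 < y (i y) ↔ 0 < z (i y) := by grind
    simp only [this]

theorem not_isBounded_fixedPoints {k : ℕ} {τ : (Fin (k + 1) → ℝ) → Fin (k + 1) → ℝ}
    (hc : Continuous τ) (hτ : Function.Involutive τ) (h0 : τ 0 = 0) {q : Fin (k + 1) → ℝ}
    (hq : q ≠ 0) (hτq : τ q = q) : ¬ Bornology.IsBounded (Function.fixedPoints τ) := by
  intro hb
  obtain ⟨ρ, hρ⟩ := hb.exists_norm_le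
  have hρ0 : 0 ≤ ρ := (norm_nonneg _).trans (hρ 0 h0)
  obtain ⟨label, hlt, hneg, hball⟩ := exists_label k
  set f : (Fin (k + 1) → ℝ) → Fin (k + 1) → ℝ := fun x => x - τ x with hf
  have hf0 : ∀ x ∈ outer (k + 1) ρ, f x ≠ 0 := fun x hx h =>
    not_le.2 hx (hρ x (sub_eq_zero.1 h).symm)
  have hS : IsGauge (outer (k + 1) ρ) {A | ∀ x ∈ A, ∀ y ∈ A,
      label (f x) / 2 = label (f y) / 2 → label (f x) = label (f y)} := by
    refine ⟨by simp, fun hA hB x hx y hy => hA x (hB hx) y (hB hy), fun x hx => ?_⟩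
    refine ⟨f ⁻¹' Metric.ball (f x) (‖f x‖ / 2), mem_nhdsWithin_of_mem_nhds ?_,
      fun y hy z hz => hball _ (hf0 x hx) _ hy _ hz⟩
    refine (show Continuous f by fun_prop).continuousAt.preimage_mem_nhds (Metric.ball_mem_nhds _ ?_)
    have := norm_pos_iff.2 (hf0 x hx)
    positivity
  obtain ⟨c, h, h'⟩ := exists_isSmith_bounds hc hτ h0 hq hτq hρ0 hS
  refine h.not_bounds (fun x => label (f x)) (fun x hx => ?_) (fun x _ => hlt _)
    (fun A hA => hA) h'
  have : f (τ x) = -f x := by simp [hf, hτ x]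
  simp only [this]
  exact hneg _ (hf0 x hx)

/-- A continuous involution of a Euclidean space with bounded fixed point set has at most one
fixed point. -/
theorem fixedPoints_subsingleton {E : Type*} [NormedAddCommGroup E] [NormedSpace ℝ E] {m : ℕ}
    (e : E ≃L[ℝ] (Fin m → ℝ)) {R : E → E} (hc : Continuous R) (hR : Function.Involutive R)
    (hb : Bornology.IsBounded (Function.fixedPoints R)) :
    (Function.fixedPoints R).Subsingleton := by
  intro p hp q hq
  cases m with
  | zero => exact e.injective (Subsingleton.elim _ _)
  | succ k =>
    by_contra hpq
    have hp' : R p = p := hp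
    have hq' : R q = q := hq
    refine not_isBounded_fixedPoints (τ := fun y => e (R (e.symm y + p) - p)) (by fun_prop) ?_ ?_
      (q := e (q - p)) ?_ ?_ ?_
    · intro y
      simp [hR _]
    · simp [hp']
    · simpa [sub_eq_zero] using Ne.symm hpq
    · simp [hq']
    · obtain ⟨C, hC⟩ := hb.exists_norm_le
      refine isBounded_iff_forall_norm_le.2 ⟨‖(e : E →L[ℝ] (Fin (k + 1) → ℝ))‖ * (C + ‖p‖), ?_⟩
      intro y hy
      have h1 : e (R (e.symm y + p) - p) = y := hy
      have h2 : R (e.symm y + p) = e.symm y + p := by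
        rw [← sub_eq_iff_eq_add, ← e.symm_apply_apply (R _ - p), h1]
      have h3 : y = (e : E →L[ℝ] (Fin (k + 1) → ℝ)) (e.symm y + p - p) := by simp
      rw [h3]
      refine (ContinuousLinearMap.le_opNorm _ _).trans ?_
      gcongr
      exact (norm_sub_le _ _).trans (by gcongr; exact hC _ h2)

/-- A fixed point of a differentiable involution at which the derivative has a fixed vector is
not isolated among the fixed points. -/
theorem exists_fixedPoint_ne {E : Type*} [NormedAddCommGroup E] [NormedSpace ℝ E]
    [CompleteSpace E] {R : E → E} (hR : Function.Involutive R) {p v : E} {L : E →L[ℝ] E}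
    (hL : HasStrictFDerivAt R L p) (hp : R p = p) (hv : v ≠ 0) (hLv : L v = v) :
    ∃ q ≠ p, R q = q := by
  have hLL : L ∘L L = ContinuousLinearMap.id ℝ E := by
    have h1 : HasFDerivAt (R ∘ R) (L ∘L L) p :=
      HasFDerivAt.comp p (by rw [hp]; exact hL.hasFDerivAt) hL.hasFDerivAt
    rw [hR.comp_self] at h1
    exact h1.unique (hasFDerivAt_id p)
  have hLL' : ∀ x, L (L x) = x := fun x => congrArg (fun f : E →L[ℝ] E => f x) hLL
  set h : E → E := fun x => (x - p) + L (R x - p) with hh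
  have hhR : ∀ x, h (R x) = L (h x) := fun x => by
    simp only [hh, hR x, map_add, hLL']
    exact add_comm _ _
  let A : E ≃L[ℝ] E := ContinuousLinearEquiv.smulLeft (Units.mk0 (2 : ℝ) two_ne_zero)
  have hA : HasStrictFDerivAt h (A : E →L[ℝ] E) p := by
    have h1 : HasStrictFDerivAt h (ContinuousLinearMap.id ℝ E + L ∘L L) p :=
      ((hasStrictFDerivAt_id p).sub_const p).add
        (L.hasStrictFDerivAt.comp p (hL.sub_const p))
    convert h1 using 1
    rw [hLL]
    ext x
    simp [A, two_smul]
  have hp0 : h p = 0 := by simp [hh, hp]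
  set g := hA.localInverse h A p with hg
  have hgt : Filter.Tendsto g (𝓝 0) (𝓝 p) := hp0 ▸ hA.localInverse_tendsto
  have h1 : ∀ᶠ y in 𝓝 (0 : E), h (g y) = y := hp0 ▸ hA.eventually_right_inverse
  have h2 : ∀ᶠ y in 𝓝 (0 : E), g (h (R (g y))) = R (g y) := by
    have h3 : Filter.Tendsto (fun y => R (g y)) (𝓝 0) (𝓝 p) := by
      have := hL.continuousAt.tendsto.comp hgt
      rwa [hp] at this
    exact h3.eventually hA.eventually_left_inverse
  have h3 : Filter.Tendsto (fun t : ℝ => t • v) (𝓝[≠] 0) (𝓝 0) := by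
    have : Filter.Tendsto (fun t : ℝ => t • v) (𝓝 0) (𝓝 ((0 : ℝ) • v)) :=
      (show Continuous fun t : ℝ => t • v by fun_prop).tendsto 0
    rw [zero_smul] at this
    exact this.mono_left nhdsWithin_le_nhds
  obtain ⟨t, ⟨h4, h5⟩, ht⟩ := ((h3.eventually (h1.and h2)).and self_mem_nhdsWithin).exists
  refine ⟨g (t • v), fun h6 => ?_, ?_⟩
  · rw [h6, hp0] at h4
    exact smul_ne_zero ht hv h4.symm
  · rw [← h5, hhR, h4, map_smul, hLv]

end FixedPoints

theorem stdSymplecticForm_ne_zero {n : ℕ} (hn : 0 < n) : stdSymplecticForm n ≠ 0 := by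
  intro h
  have h1 := congrArg (fun ω => ω (EuclideanSpace.single ⟨2 * 0, by omega⟩ 1)
    (EuclideanSpace.single ⟨2 * 0 + 1, by omega⟩ 1)) h
  simp only [stdSymplecticForm, sum_apply, sub_apply, ContinuousLinearMap.smulRight_apply,
    smul_apply, zero_apply, PiLp.proj_apply, EuclideanSpace.single, PiLp.single_apply,
    Fin.mk.injEq, smul_eq_mul] at h1
  rw [Finset.sum_eq_single ⟨0, hn⟩ ?_ (by simp)] at h1
  · simp at h1
  · intro i _ hi
    have : (i : ℕ) ≠ 0 := fun h => hi (Fin.ext h)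
    simp [this]

end SmallChain

/-- There is no closed real Lagrangian submanifold in the standard
symplectic vector space `(ℝ^(2n), ω₀)`, `n ≥ 1`: the fixed point set of an antisymplectic
involution of `(ℝ^(2n), ω₀)`, if nonempty, is automatically a Lagrangian submanifold, and
it is never a nonempty compact (boundaryless) manifold — it is never compact at all. -/
theorem no_closed_real_lagrangian_in_R2n (n : ℕ) (hn : 0 < n)
    (R : EuclideanSpace ℝ (Fin (2 * n)) → EuclideanSpace ℝ (Fin (2 * n)))
    (hR : IsAntisymplecticInvolution 𝓘(ℝ, EuclideanSpace ℝ (Fin (2 * n)))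
      (EuclideanSpace ℝ (Fin (2 * n))) (fun _ => stdSymplecticForm n) R)
    (hne : {x | R x = x}.Nonempty) :
    ¬ IsCompact {x | R x = x} := by
  intro hK
  obtain ⟨hsm, hinv, hω⟩ := hR
  obtain ⟨p, hp⟩ := hne
  have hp : R p = p := hp
  have hR : Function.Involutive R := congrFun hinv
  have hsm' : ContDiff ℝ (⊤ : ℕ∞) R := hsm.contDiff
  have hL : HasStrictFDerivAt R (fderiv ℝ R p) p :=
    hsm'.contDiffAt.hasStrictFDerivAt (by simp)
  have hLL : ∀ x, fderiv ℝ R p (fderiv ℝ R p x) = x := fun x => by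
    have h1 : HasFDerivAt (R ∘ R) (fderiv ℝ R p ∘L fderiv ℝ R p) p :=
      HasFDerivAt.comp p (by rw [hp]; exact hL.hasFDerivAt) hL.hasFDerivAt
    rw [hR.comp_self] at h1
    exact congrArg (fun f => f x) (h1.unique (hasFDerivAt_id p))
  by_cases hu : ∃ u, u + fderiv ℝ R p u ≠ 0
  · obtain ⟨u, hu⟩ := hu
    obtain ⟨q, hqp, hq⟩ := SmallChain.exists_fixedPoint_ne hR hL hp hu
      (by rw [map_add, hLL, add_comm])
    exact hqp (SmallChain.fixedPoints_subsingleton (EuclideanSpace.equiv (Fin (2 * n)) ℝ)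
      hsm'.continuous hR hK.isBounded hq hp)
  · push Not at hu
    refine SmallChain.stdSymplecticForm_ne_zero hn ?_
    ext u v
    have h1 : stdSymplecticForm n (fderiv ℝ R p u) (fderiv ℝ R p v) =
        -stdSymplecticForm n u v := by
      have := hω p u v
      rw [mfderiv_eq_fderiv] at this
      exact this
    rw [eq_neg_of_add_eq_zero_right (hu u), eq_neg_of_add_eq_zero_right (hu v)] at h1
    simp only [map_neg, neg_apply, neg_neg] at h1
    simpa using self_eq_neg.1 h1

end
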